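/- arXiv:2102.02159 — 2 statements merged into one kernel-verified Lean document; each statement's English description precedes it below -/
import Mathlib

section
/- Let $I_1, \ldots, I_n$ be $p \times p$ real positive semidefinite matrices with total $\mathcal{I}_Y = \sum_{i=1}^n I_i$, and for $r \subseteq \{1,\ldots,n\}$ write $\mathcal{I}_r = \sum_{i \in r} I_i$. Let $R$ be a random subset of $\{1,\ldots,n\}$ with finite support such that $\mathbb{P}(i \in R) = f$ for some $0 < f < 1$ and all $i$, and such that $\mathcal{I}_r$ is positive definite (hence invertible) for every $r$ in the support of $R$. Let $\varphi$ be a real-valued function on the set of $p \times p$ real positive definite matrices that is convex (i.e. $\varphi(tA + (1-t)B) \le t\varphi(A) + (1-t)\varphi(B)$ for all positive definite $A, B$ and $t \in (0,1)$) and monotone with respect to the Loewner order (i.e. $A \le B$, meaning $B - A$ positive semidefinite, implies $\varphi(A) \le \varphi(B)$). Then $\varphi\{f^{-1} \mathcal{I}_Y^{-1}\} \le E[\varphi\{\mathcal{I}_R^{-1}\}]$, where the expectation is over the distribution of $R$. -/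
open Matrix

/-- The set of positive definite real matrices is convex. -/
theorem convex_setOf_posDef (m : Type*) [Fintype m] :
    Convex ℝ {A : Matrix m m ℝ | A.PosDef} :=
  convex_iff_forall_pos.2 fun _ hA _ hB _ _ ha hb _ => (hA.smul ha).add (hB.smul hb)

/-- Jensen's inequality for matrix inversion in the Loewner order. -/
theorem posSemidef_sum_smul_inv_sub_inv_sum_smul {m ι : Type*} [Fintype m] [DecidableEq m]
    (s : Finset ι) (w : ι → ℝ) (A : ι → Matrix m m ℝ) (hw : ∀ i ∈ s, 0 ≤ w i)
    (hsum : ∑ i ∈ s, w i = 1) (hA : ∀ i ∈ s, (A i).PosDef) :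
    (∑ i ∈ s, w i • (A i)⁻¹ - (∑ i ∈ s, w i • A i)⁻¹).PosSemidef := by
  have hMpos : (∑ i ∈ s, w i • A i).PosDef :=
    (convex_setOf_posDef m).sum_mem hw hsum hA
  set M := ∑ i ∈ s, w i • A i with hM
  have hMdet : IsUnit M.det := (Matrix.isUnit_iff_isUnit_det M).1 hMpos.isUnit
  have hterm : ∀ i ∈ s, w i • (((A i)⁻¹ - M⁻¹) * A i * ((A i)⁻¹ - M⁻¹)) =
      w i • (A i)⁻¹ - (2 * w i) • M⁻¹ + M⁻¹ * (w i • A i) * M⁻¹ := by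
    intro i hi
    have hdet : IsUnit (A i).det := (Matrix.isUnit_iff_isUnit_det _).1 (hA i hi).isUnit
    rw [sub_mul, Matrix.nonsing_inv_mul _ hdet, sub_mul, one_mul, mul_sub, mul_assoc M⁻¹ (A i),
      Matrix.mul_nonsing_inv _ hdet, mul_one, Matrix.mul_smul, Matrix.smul_mul, mul_assoc]
    module
  have hkey : ∑ i ∈ s, w i • (A i)⁻¹ - M⁻¹ =
      ∑ i ∈ s, w i • (((A i)⁻¹ - M⁻¹) * A i * ((A i)⁻¹ - M⁻¹)) := by
    rw [Finset.sum_congr rfl hterm, Finset.sum_add_distrib, Finset.sum_sub_distrib,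
      ← Finset.sum_smul, ← Finset.mul_sum, hsum, ← Finset.sum_mul, ← Finset.mul_sum, ← hM,
      Matrix.nonsing_inv_mul _ hMdet, one_mul]
    module
  rw [hkey]
  refine Matrix.posSemidef_sum s fun i hi => Matrix.PosSemidef.smul ?_ (hw i hi)
  have hherm : ((A i)⁻¹ - M⁻¹).IsHermitian := (hA i hi).inv.isHermitian.sub hMpos.inv.isHermitian
  simpa only [hherm.eq] using (hA i hi).posSemidef.mul_mul_conjTranspose_same ((A i)⁻¹ - M⁻¹)

/-- **Proposition 1 (selection-set inequality, non-strict form).**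
`I 1, …, I n` are `p × p` positive semidefinite information matrices with total
`𝓘_Y = ∑ i, I i`.  A splitting strategy is a finitely supported random subset of
`{1, …, n}`, encoded by its support `𝓡` and probabilities `w`, such that every index
belongs to the selected subset with the same probability `f ∈ (0, 1)` and the split
information `𝓘_r = ∑ i ∈ r, I i` is positive definite for every `r` in the support.
If `φ` is a real-valued function on positive definite matrices that is convex and
monotone for the Loewner order, then
`φ (f⁻¹ • 𝓘_Y⁻¹) ≤ E[φ (𝓘_R⁻¹)] = ∑ r, P(R = r) * φ (𝓘_r⁻¹)`. -/
theorem selection_split_inequality {p n : ℕ}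
    (I : Fin n → Matrix (Fin p) (Fin p) ℝ) (hI : ∀ i, (I i).PosSemidef)
    (𝓡 : Finset (Finset (Fin n))) (w : Finset (Fin n) → ℝ)
    (hw : ∀ r ∈ 𝓡, 0 < w r) (hsum : ∑ r ∈ 𝓡, w r = 1)
    (f : ℝ) (hf0 : 0 < f) (hf1 : f < 1)
    (hmarg : ∀ i : Fin n, ∑ r ∈ 𝓡, (if i ∈ r then w r else 0) = f)
    (hpos : ∀ r ∈ 𝓡, (∑ i ∈ r, I i).PosDef)
    (φ : Matrix (Fin p) (Fin p) ℝ → ℝ)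
    (hconv : ∀ A B : Matrix (Fin p) (Fin p) ℝ, A.PosDef → B.PosDef →
      ∀ t : ℝ, 0 < t → t < 1 → φ (t • A + (1 - t) • B) ≤ t * φ A + (1 - t) * φ B)
    (hmono : ∀ A B : Matrix (Fin p) (Fin p) ℝ, A.PosDef → B.PosDef →
      (B - A).PosSemidef → φ A ≤ φ B) :
    φ (f⁻¹ • (∑ i, I i)⁻¹) ≤ ∑ r ∈ 𝓡, w r * φ ((∑ i ∈ r, I i)⁻¹) := by
  have hmean : ∑ r ∈ 𝓡, w r • ∑ i ∈ r, I i = f • ∑ i, I i := by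
    calc ∑ r ∈ 𝓡, w r • ∑ i ∈ r, I i
        = ∑ r ∈ 𝓡, ∑ i, (if i ∈ r then w r else 0) • I i := by
          simp [Finset.smul_sum, ite_smul]
      _ = f • ∑ i, I i := by
          rw [Finset.sum_comm, Finset.smul_sum]
          exact Finset.sum_congr rfl fun i _ => by rw [← Finset.sum_smul, hmarg i]
  have hw0 : ∀ r ∈ 𝓡, 0 ≤ w r := fun r hr => (hw r hr).le
  have hMpos : (f • ∑ i, I i).PosDef :=
    hmean ▸ (convex_setOf_posDef (Fin p)).sum_mem hw0 hsum hpos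
  have hYpos : (∑ i, I i).PosDef := by
    simpa [smul_smul, hf0.ne'] using hMpos.smul (inv_pos.2 hf0)
  have hinv : (f • ∑ i, I i)⁻¹ = f⁻¹ • (∑ i, I i)⁻¹ :=
    Matrix.inv_smul' _ (Units.mk0 f hf0.ne') ((Matrix.isUnit_iff_isUnit_det _).1 hYpos.isUnit)
  have hφ : ConvexOn ℝ {A : Matrix (Fin p) (Fin p) ℝ | A.PosDef} φ := by
    refine convexOn_iff_forall_pos.2 ⟨convex_setOf_posDef (Fin p), ?_⟩
    intro A hA B hB a b ha hb hab
    obtain rfl : b = 1 - a := by linarith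
    exact hconv A B hA hB a ha (by linarith)
  have hinvpos : ∀ r ∈ 𝓡, ((∑ i ∈ r, I i)⁻¹).PosDef := fun r hr => (hpos r hr).inv
  calc φ (f⁻¹ • (∑ i, I i)⁻¹) ≤ φ (∑ r ∈ 𝓡, w r • (∑ i ∈ r, I i)⁻¹) := by
        refine hmono _ _ (hYpos.inv.smul (inv_pos.2 hf0))
          ((convex_setOf_posDef (Fin p)).sum_mem hw0 hsum hinvpos) ?_
        rw [← hinv, ← hmean]
        exact posSemidef_sum_smul_inv_sub_inv_sum_smul 𝓡 w _ hw0 hsum hpos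
    _ ≤ ∑ r ∈ 𝓡, w r * φ ((∑ i ∈ r, I i)⁻¹) := hφ.map_sum_le hw0 hsum hinvpos
end

section
/- Let $I_1, \ldots, I_n$ be $p \times p$ real positive semidefinite matrices with total $\mathcal{I}_Y = \sum_{i=1}^n I_i$, and for $r \subseteq \{1,\ldots,n\}$ write $\mathcal{I}_{r^c} = \sum_{i \notin r} I_i$. Let $R$ be a random subset of $\{1,\ldots,n\}$ with finite support such that $\mathbb{P}(i \in R) = f$ for some $0 < f < 1$ and all $i$, and such that $\mathcal{I}_{r^c}$ is positive definite for every $r$ in the support of $R$. Let $\varphi$ be a real-valued function on the set of $p \times p$ real positive definite matrices that is convex and monotone with respect to the Loewner order. Then $\varphi\{(1-f)^{-1} \mathcal{I}_Y^{-1}\} \le E[\varphi\{\mathcal{I}_{R^c}^{-1}\}]$, where $R^c$ denotes the complement of $R$ in $\{1,\ldots,n\}$. -/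
open Matrix

/-- Expansion of a square around `T⁻¹`: `M⁻¹ ≥ 2 T⁻¹ - T⁻¹ M T⁻¹` in the Loewner order. -/
theorem posSemidef_inv_add_conj_sub {m : Type*} [Fintype m] [DecidableEq m]
    {M T : Matrix m m ℝ} (hM : M.PosDef) (hT : T.PosDef) :
    (M⁻¹ + T⁻¹ * M * T⁻¹ - (2 : ℝ) • T⁻¹).PosSemidef := by
  have hdet : IsUnit M.det := (isUnit_iff_isUnit_det M).1 hM.isUnit
  have hherm : (M⁻¹ - T⁻¹)ᴴ = M⁻¹ - T⁻¹ := (hM.inv.1.sub hT.inv.1).eq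
  have h := hM.posSemidef.mul_mul_conjTranspose_same (M⁻¹ - T⁻¹)
  rw [hherm] at h
  convert h using 1
  rw [sub_mul, nonsing_inv_mul _ hdet, sub_mul, one_mul, mul_sub,
    mul_nonsing_inv_cancel_right _ _ hdet, two_smul]
  abel

/-- Jensen's inequality in the Loewner order for the inverse of positive definite matrices. -/
theorem posSemidef_sum_smul_inv_sub_inv_sum {m ι : Type*} [Fintype m] [DecidableEq m]
    (s : Finset ι) (w : ι → ℝ) (M : ι → Matrix m m ℝ) (hw : ∀ r ∈ s, 0 ≤ w r)
    (hsum : ∑ r ∈ s, w r = 1) (hM : ∀ r ∈ s, (M r).PosDef) :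
    (∑ r ∈ s, w r • (M r)⁻¹ - (∑ r ∈ s, w r • M r)⁻¹).PosSemidef := by
  set T := ∑ r ∈ s, w r • M r with hTdef
  have hT : T.PosDef := (convex_setOf_posDef m).sum_mem hw hsum hM
  have hdet : IsUnit T.det := (isUnit_iff_isUnit_det T).1 hT.isUnit
  have h : (∑ r ∈ s, w r • ((M r)⁻¹ + T⁻¹ * M r * T⁻¹ - (2 : ℝ) • T⁻¹)).PosSemidef :=
    posSemidef_sum s fun r hr => (posSemidef_inv_add_conj_sub (hM r hr) hT).smul (hw r hr)
  have hconj : ∑ r ∈ s, w r • (T⁻¹ * M r * T⁻¹) = T⁻¹ := by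
    calc ∑ r ∈ s, w r • (T⁻¹ * M r * T⁻¹) = T⁻¹ * T * T⁻¹ := by
          rw [hTdef, Finset.mul_sum, Finset.sum_mul]
          simp only [mul_smul_comm, smul_mul_assoc]
      _ = T⁻¹ := by rw [nonsing_inv_mul _ hdet, one_mul]
  convert h using 1
  simp only [smul_sub, smul_add, Finset.sum_sub_distrib, Finset.sum_add_distrib]
  rw [hconj, ← Finset.sum_smul, hsum, one_smul, two_smul]
  abel

/-- The expected sum over the complement of a random set with constant marginals `f`. -/
theorem sum_smul_sum_compl {ι V : Type*} [Fintype ι] [DecidableEq ι] [AddCommGroup V] [Module ℝ V]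
    (x : ι → V) (s : Finset (Finset ι)) (w : Finset ι → ℝ) (hsum : ∑ r ∈ s, w r = 1) (f : ℝ)
    (hmarg : ∀ i, ∑ r ∈ s, (if i ∈ r then w r else 0) = f) :
    ∑ r ∈ s, w r • ∑ i ∈ rᶜ, x i = (1 - f) • ∑ i, x i := by
  have hcoef (i : ι) : ∑ r ∈ s, (if i ∈ rᶜ then w r else 0) = 1 - f := by
    rw [← hsum, ← hmarg i, ← Finset.sum_sub_distrib]
    refine Finset.sum_congr rfl fun r _ => ?_
    by_cases h : i ∈ r <;> simp [h]
  calc ∑ r ∈ s, w r • ∑ i ∈ rᶜ, x i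
      = ∑ r ∈ s, ∑ i, (if i ∈ rᶜ then w r else 0) • x i := by
        refine Finset.sum_congr rfl fun r _ => ?_
        simp only [ite_smul, zero_smul, Finset.sum_ite_mem, Finset.univ_inter, Finset.smul_sum]
    _ = (1 - f) • ∑ i, x i := by
        rw [Finset.sum_comm, Finset.smul_sum]
        refine Finset.sum_congr rfl fun i _ => ?_
        rw [← Finset.sum_smul, hcoef]

/-- **Proposition 1 (inference-set inequality, non-strict form).**
`I 1, …, I n` are `p × p` positive semidefinite information matrices with total
`𝓘_Y = ∑ i, I i`.  A splitting strategy is a finitely supported random subset of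
`{1, …, n}`, encoded by its support `𝓡` and probabilities `w`, such that every index
belongs to the selected subset with the same probability `f ∈ (0, 1)` and the
inference-split information `𝓘_{rᶜ} = ∑ i ∈ rᶜ, I i` is positive definite for every
`r` in the support.  If `φ` is a real-valued function on positive definite matrices
that is convex and monotone for the Loewner order, then
`φ ((1 - f)⁻¹ • 𝓘_Y⁻¹) ≤ E[φ (𝓘_{Rᶜ}⁻¹)] = ∑ r, P(R = r) * φ (𝓘_{rᶜ}⁻¹)`. -/
theorem inference_split_inequality {p n : ℕ}
    (I : Fin n → Matrix (Fin p) (Fin p) ℝ) (hI : ∀ i, (I i).PosSemidef)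
    (𝓡 : Finset (Finset (Fin n))) (w : Finset (Fin n) → ℝ)
    (hw : ∀ r ∈ 𝓡, 0 < w r) (hsum : ∑ r ∈ 𝓡, w r = 1)
    (f : ℝ) (hf0 : 0 < f) (hf1 : f < 1)
    (hmarg : ∀ i : Fin n, ∑ r ∈ 𝓡, (if i ∈ r then w r else 0) = f)
    (hpos : ∀ r ∈ 𝓡, (∑ i ∈ rᶜ, I i).PosDef)
    (φ : Matrix (Fin p) (Fin p) ℝ → ℝ)
    (hconv : ∀ A B : Matrix (Fin p) (Fin p) ℝ, A.PosDef → B.PosDef →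
      ∀ t : ℝ, 0 < t → t < 1 → φ (t • A + (1 - t) • B) ≤ t * φ A + (1 - t) * φ B)
    (hmono : ∀ A B : Matrix (Fin p) (Fin p) ℝ, A.PosDef → B.PosDef →
      (B - A).PosSemidef → φ A ≤ φ B) :
    φ ((1 - f)⁻¹ • (∑ i, I i)⁻¹) ≤ ∑ r ∈ 𝓡, w r * φ ((∑ i ∈ rᶜ, I i)⁻¹) := by
  have hw0 : ∀ r ∈ 𝓡, 0 ≤ w r := fun r hr => (hw r hr).le
  have hφ : ConvexOn ℝ {A : Matrix (Fin p) (Fin p) ℝ | A.PosDef} φ := by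
    refine convexOn_iff_forall_pos.2 ⟨convex_setOf_posDef _, fun A hA B hB a b ha hb hab => ?_⟩
    obtain rfl : b = 1 - a := by linarith
    exact hconv A B hA hB a ha (by linarith)
  have hinv : ∀ r ∈ 𝓡, ((∑ i ∈ rᶜ, I i)⁻¹).PosDef := fun r hr => (hpos r hr).inv
  have hmean := sum_smul_sum_compl I 𝓡 w hsum f hmarg
  have hmean_pos : ((1 - f) • ∑ i, I i).PosDef :=
    hmean ▸ (convex_setOf_posDef (Fin p)).sum_mem hw0 hsum hpos
  have hmean_inv : ((1 - f) • ∑ i, I i)⁻¹ = (1 - f)⁻¹ • (∑ i, I i)⁻¹ := by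
    have hf : 1 - f ≠ 0 := by linarith
    have hdet : IsUnit ((1 - f) • ∑ i, I i).det :=
      (isUnit_iff_isUnit_det _).1 hmean_pos.isUnit
    have hdetY : IsUnit (∑ i, I i).det := by
      rw [det_smul] at hdet
      exact isUnit_of_mul_isUnit_right hdet
    exact inv_smul' (∑ i, I i) (Units.mk0 (1 - f) hf) hdetY
  have hjensen := posSemidef_sum_smul_inv_sub_inv_sum 𝓡 w (fun r => ∑ i ∈ rᶜ, I i) hw0 hsum hpos
  rw [hmean] at hjensen
  rw [← hmean_inv]
  calc φ ((1 - f) • ∑ i, I i)⁻¹ ≤ φ (∑ r ∈ 𝓡, w r • (∑ i ∈ rᶜ, I i)⁻¹) :=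
        hmono _ _ hmean_pos.inv ((convex_setOf_posDef (Fin p)).sum_mem hw0 hsum hinv) hjensen
    _ ≤ ∑ r ∈ 𝓡, w r * φ ((∑ i ∈ rᶜ, I i)⁻¹) := hφ.map_sum_le hw0 hsum hinv
end
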